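/- Let n ≥ 2 be an integer, α > 0, p ∈ {1,…,n−1} coprime to n, and let g be a type (i) coupling satisfying the quantisation condition M ∈ ℤ ∖ {0}. Then for every r ∈ {1,…,n−1}, every complex-valued function φ on the lattice ρ_p+sgn(M)Λ⁺_{p,|M|}, and every μ ∈ Λ⁺_{p,|M|}, the intertwining relation Σ_{ν∈S_n(ω_r), μ+ν∈Λ⁺_{p,|M|}} W_ν(ρ_p+sgn(M)μ) · √(Δ_p(μ+ν)) · φ(ρ_p+sgn(M)(μ+ν)) = √(Δ_p(μ)) · Σ_{ν∈S_n(ω_r), μ+ν∈Λ⁺_{p,|M|}} V_ν(g; ρ_p+sgn(M)μ) · φ(ρ_p+sgn(M)(μ+ν)) holds. -/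

import Mathlib

noncomputable section
open Real Finset
open scoped Classical

/-- The standard basis vector `e_j` of `ℝⁿ` (1-based index), extended `n`-periodically
(`e_{n+j} = e_j`). -/
def ee (n j : ℕ) : Fin n → ℝ := fun i => if ((i : ℕ) + 1) % n = j % n then 1 else 0

/-- The standard inner product on `ℝⁿ`. -/
def inn {n : ℕ} (x y : Fin n → ℝ) : ℝ := ∑ i, x i * y i

/-- The coordinate `x_j` (1-based index) with the convention `x_{n+k} = x_k - 2π/α`. -/
def coord {n : ℕ} (α : ℝ) (x : Fin n → ℝ) (j : ℕ) : ℝ :=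
  if h : 0 < n then x ⟨(j - 1) % n, Nat.mod_lt _ h⟩ - 2 * π / α * (((j - 1) / n : ℕ) : ℝ)
  else 0

/-- The simple roots `a_{j,p} = e_j - e_{j+p}`. -/
def aa (n p j : ℕ) : Fin n → ℝ := ee n j - ee n (j + p)

/-- The closed simplex `Σ̄_{g,p} = {x ∈ E_n : sgn(M)(x_j - x_{j+p} - g) ≥ 0, j = 1,…,n}`,
where `M = 2πp/α - ng`. -/
def SigmaBar (n p : ℕ) (α g : ℝ) : Set (Fin n → ℝ) :=
  {x | (∑ i, x i) = 0 ∧ ∀ j ∈ Icc 1 n,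
    0 ≤ Real.sign (2 * π * p / α - n * g) * (coord α x j - coord α x (j + p) - g)}

/-- The interior `Σ_{g,p}` of the simplex, cut out by the strict inequalities. -/
def SigmaInt (n p : ℕ) (α g : ℝ) : Set (Fin n → ℝ) :=
  {x | (∑ i, x i) = 0 ∧ ∀ j ∈ Icc 1 n,
    0 < Real.sign (2 * π * p / α - n * g) * (coord α x j - coord α x (j + p) - g)}

/-- `g` is a type (i) coupling, with `q ∈ {1,…,n-1}` the multiplicative inverse of `p` mod `n`. -/
def TypeI (n p q : ℕ) (α g : ℝ) : Prop :=
  1 ≤ q ∧ q ≤ n - 1 ∧ (p * q) % n = 1 % n ∧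
  ((2 * π / α * ((p : ℝ) / n - 1 / ((n : ℝ) * q)) < g ∧ g < 2 * π / α * ((p : ℝ) / n)) ∨
   (2 * π / α * ((p : ℝ) / n) < g ∧
      g < 2 * π / α * ((p : ℝ) / n + 1 / ((n : ℝ) * ((n : ℝ) - q)))))

/-- `ρ_p = g(ω_{1,p}+…+ω_{n-p,p}) + (g - 2π/α)(ω_{n-p+1,p}+…+ω_{n-1,p})`. -/
def rhoP (n p : ℕ) (α g : ℝ) (ω : ℕ → Fin n → ℝ) : Fin n → ℝ :=
  g • (∑ j ∈ Icc 1 (n - p), ω j) + (g - 2 * π / α) • (∑ j ∈ Icc (n - p + 1) (n - 1), ω j)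

/-- `Λ⁺_{p,|M|}`: nonnegative integral combinations of the `ω_{j,p}` with coefficient sum `≤ |M|`. -/
def Lam (n : ℕ) (Mabs : ℝ) (ω : ℕ → Fin n → ℝ) : Set (Fin n → ℝ) :=
  {μ | ∃ m : ℕ → ℕ, (∑ j ∈ Icc 1 (n - 1), (m j : ℝ)) ≤ Mabs ∧
    μ = ∑ j ∈ Icc 1 (n - 1), (m j : ℝ) • ω j}

/-- The fundamental weight `ω_r = e_1+…+e_r - (r/n)(e_1+…+e_n)`. -/
def omegaStd (n r : ℕ) : Fin n → ℝ :=
  fun i => (if (i : ℕ) + 1 ≤ r then 1 else 0) - (r : ℝ) / n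

/-- Membership in the orbit `S_n(ω_r)` of `ω_r` under coordinate permutations. -/
def inOrbit (n r : ℕ) (ν : Fin n → ℝ) : Prop :=
  ∃ σ : Equiv.Perm (Fin n), ν = fun i => omegaStd n r (σ i)

/-- The orbit `S_n(ω_r)` as a finite set. -/
def orbitF (n r : ℕ) : Finset (Fin n → ℝ) :=
  Finset.image (fun σ : Equiv.Perm (Fin n) => fun i => omegaStd n r (σ i)) Finset.univ

/-- `V_ν(g;x) = ∏_{a ∈ A_{n-1}, ⟨a,ν⟩=1} sin(α(⟨a,x⟩+g)/2)/sin(α⟨a,x⟩/2)`. -/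
def Vnu (n : ℕ) (α g : ℝ) (ν x : Fin n → ℝ) : ℝ :=
  ∏ j ∈ Icc 1 n, ∏ k ∈ Icc 1 n,
    if j ≠ k ∧ inn (ee n j - ee n k) ν = 1 then
      Real.sin (α * (inn (ee n j - ee n k) x + g) / 2) /
        Real.sin (α * inn (ee n j - ee n k) x / 2)
    else 1

/-- `V_J(g;x) = ∏_{j∈J, k∉J} sin(α(x_j-x_k+g)/2)/sin(α(x_j-x_k)/2)`. -/
def VJ (n : ℕ) (α g : ℝ) (J : Finset ℕ) (x : Fin n → ℝ) : ℝ :=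
  ∏ j ∈ J, ∏ k ∈ Icc 1 n \ J,
    Real.sin (α * (coord α x j - coord α x k + g) / 2) /
      Real.sin (α * (coord α x j - coord α x k) / 2)

/-- `F_J(g;x) = ∏_{j,k∈J, j≠k} sin(α(x_j-x_k)/2)/sin(α(x_j-x_k+g)/2)`. -/
def FJ (n : ℕ) (α g : ℝ) (J : Finset ℕ) (x : Fin n → ℝ) : ℝ :=
  ∏ j ∈ J, ∏ k ∈ J,
    if j ≠ k then
      Real.sin (α * (coord α x j - coord α x k) / 2) /
        Real.sin (α * (coord α x j - coord α x k + g) / 2)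
    else 1

/-- The trigonometric Pochhammer symbol `(z : sin_α)_m`. -/
def poch (α z : ℝ) (m : ℤ) : ℝ :=
  if 0 ≤ m then ∏ l ∈ Finset.range m.toNat, Real.sin (α * (z + l) / 2)
  else 1 / ∏ l ∈ Finset.Icc 1 (-m).toNat, Real.sin (α * (z - l) / 2)

/-- Membership in the set of positive roots `A⁺_{n-1,p}`. -/
def inPosRoots (n p : ℕ) (v : Fin n → ℝ) : Prop :=
  (∃ j ∈ Icc 1 n, ∃ k ∈ Icc 1 n, j ≠ k ∧ v = ee n j - ee n k) ∧
  ∃ c : ℕ → ℕ, v = ∑ j ∈ Icc 1 (n - 1), (c j : ℝ) • aa n p j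

/-- The lattice function `Δ_p(μ)`. -/
def Delta (n p : ℕ) (α g : ℝ) (ω : ℕ → Fin n → ℝ) (μ : Fin n → ℝ) : ℝ :=
  ∏ j ∈ Icc 1 n, ∏ k ∈ Icc 1 n,
    if inPosRoots n p (ee n j - ee n k) then
      Real.sin (α * inn (ee n j - ee n k)
          (rhoP n p α g ω + Real.sign (2 * π * p / α - n * g) • μ) / 2) /
        Real.sin (α * inn (ee n j - ee n k) (rhoP n p α g ω) / 2) *
      (poch α (inn (ee n j - ee n k) (rhoP n p α g ω) +
            Real.sign (2 * π * p / α - n * g) * g)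
          ⌊Real.sign (2 * π * p / α - n * g) * inn (ee n j - ee n k) μ⌋ /
        poch α (inn (ee n j - ee n k) (rhoP n p α g ω) + 1 -
            Real.sign (2 * π * p / α - n * g) * g)
          ⌊Real.sign (2 * π * p / α - n * g) * inn (ee n j - ee n k) μ⌋)
    else 1

/-- The coefficient `W_ν(ρ_p + sgn(M)μ)` (equal to `0` when `μ + ν ∉ Λ⁺_{p,|M|}`). -/
def Wmu (n p : ℕ) (α g : ℝ) (ω : ℕ → Fin n → ℝ) (s : (Fin n → ℝ) → ℝ)
    (μ ν : Fin n → ℝ) : ℝ :=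
  if μ + ν ∈ Lam n |2 * π * p / α - n * g| ω then
    s ν * Real.sqrt
      (Vnu n α g ν (rhoP n p α g ω + Real.sign (2 * π * p / α - n * g) • μ) *
       Vnu n α g ν (-(rhoP n p α g ω) - Real.sign (2 * π * p / α - n * g) • (μ + ν)))
  else 0

/-- The discrete difference operator `Ŝ_{r,M}` acting on lattice functions. -/
def SOp (n p r : ℕ) (α g : ℝ) (ω : ℕ → Fin n → ℝ) (s : (Fin n → ℝ) → ℝ)
    (φ : (Fin n → ℝ) → ℂ) : (Fin n → ℝ) → ℂ :=
  fun x => ∑ ν ∈ orbitF n r,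
    (Wmu n p α g ω s (Real.sign (2 * π * p / α - n * g) • (x - rhoP n p α g ω)) ν : ℂ) *
      φ (x + Real.sign (2 * π * p / α - n * g) • ν)

/-- The inner product `(φ, ψ)_{p,M}` on lattice functions. -/
def ip (n p : ℕ) (α g : ℝ) (ω : ℕ → Fin n → ℝ) (φ ψ : (Fin n → ℝ) → ℂ) : ℂ :=
  ∑ᶠ μ ∈ Lam n |2 * π * p / α - n * g| ω,
    φ (rhoP n p α g ω + Real.sign (2 * π * p / α - n * g) • μ) *
      starRingEnd ℂ (ψ (rhoP n p α g ω + Real.sign (2 * π * p / α - n * g) • μ))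

/-- The elementary symmetric function `ℰ_r(u) = Σ_{ν ∈ S_n(ω_r)} exp(iα⟨ν,u⟩)`. -/
def calE (n r : ℕ) (α : ℝ) (u : Fin n → ℝ) : ℂ :=
  ∑ ν ∈ orbitF n r, Complex.exp (Complex.I * (α : ℂ) * (inn ν u : ℂ))

/-- The function `u ↦ sin (α u / 2)`. -/
def hsin (α u : ℝ) : ℝ := Real.sin (α * u / 2)

lemma hsin_neg (α u : ℝ) : hsin α (-u) = -hsin α u := by
  unfold hsin; rw [← Real.sin_neg]; congr 1; ring

lemma hsin_sub_nat (α u : ℝ) (hα : 0 < α) (N : ℕ) :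
    hsin α (u - N * (2 * π / α)) = (-1) ^ N * hsin α u := by
  unfold hsin
  rw [← Real.sin_sub_nat_mul_pi]; congr 1; field_simp

lemma hsin_pos {α u : ℝ} (hα : 0 < α) (h0 : 0 < u) (h1 : u < 2 * π / α) : 0 < hsin α u := by
  unfold hsin
  rw [lt_div_iff₀ hα] at h1
  apply Real.sin_pos_of_pos_of_lt_pi
  · positivity
  · linarith

lemma hsin_window_pos {α u : ℝ} (hα : 0 < α) (N : ℕ) (h0 : N * (2 * π / α) < u)
    (h1 : u < (N + 1) * (2 * π / α)) : 0 < (-1) ^ N * hsin α u := by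
  rw [← hsin_sub_nat α u hα N]
  exact hsin_pos hα (by linarith) (by linarith)

lemma hsin_sub_int_sign (α : ℝ) (hα : 0 < α) (c : ℤ) :
    ∃ ε : ℝ, ε * ε = 1 ∧ ∀ u, hsin α (u - c * (2 * π / α)) = ε * hsin α u := by
  obtain ⟨N, rfl | rfl⟩ := c.eq_nat_or_neg
  · refine ⟨(-1) ^ N, by rw [← mul_pow]; simp, fun u => ?_⟩
    exact_mod_cast hsin_sub_nat α u hα N
  · refine ⟨(-1) ^ N, by rw [← mul_pow]; simp, fun u => ?_⟩
    have h := hsin_sub_nat α (u + N * (2 * π / α)) hα N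
    rw [add_sub_cancel_right] at h
    push_cast
    rw [h, ← mul_assoc, ← mul_pow]
    simp

lemma le_of_eq_add_mul {A b n z : ℤ} (h : A = b + n * z) (hA : 0 ≤ A) (hb : b < n) (hn : 0 < n) :
    b ≤ A := by
  have : 0 ≤ z := by
    by_contra hz
    push Not at hz
    nlinarith
  nlinarith

/-- Writing `k p = n N + c`, the residues `c` and `n - c` control `k` and `n - k`. -/
lemma residue_bounds {n p q k : ℕ} (hn : 2 ≤ n) (hcop : Nat.Coprime p n)
    (hq1 : 1 ≤ q) (hqn : q ≤ n - 1) (hpq : (p * q) % n = 1 % n) (hk : 1 ≤ k) (hkn : k < n) :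
    ∃ N c : ℕ, k * p = n * N + c ∧ k * p / n = N ∧ 1 ≤ c ∧ c < n ∧
      (k : ℤ) ≤ c * q ∧ (n : ℤ) - k ≤ (n - c) * q ∧ (n : ℤ) - k ≤ c * (n - q) ∧
      (k : ℤ) ≤ (n - c) * (n - q) := by
  have hc0 : 1 ≤ k * p % n := by
    by_contra hc
    have hdvd : n ∣ k * p := Nat.dvd_of_mod_eq_zero (by omega)
    have := Nat.le_of_dvd hk ((Nat.Coprime.symm hcop).dvd_of_dvd_mul_right hdvd)
    omega
  have hcn : k * p % n < n := Nat.mod_lt _ (by omega)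
  have hdiv := Nat.div_add_mod (k * p) n
  refine ⟨k * p / n, k * p % n, hdiv.symm, rfl, hc0, hcn, ?_⟩
  generalize k * p % n = c at *
  generalize k * p / n = N at *
  have h1 : (1 : ℕ) % n = 1 := Nat.mod_eq_of_lt (by omega)
  have ha := Nat.div_add_mod (p * q) n
  rw [hpq, h1] at ha
  generalize p * q / n = a at ha
  have hdiv' : (n : ℤ) * N + c = k * p := by exact_mod_cast hdiv
  have ha' : (n : ℤ) * a + 1 = p * q := by exact_mod_cast ha
  have hcq : (c : ℤ) * q = k + n * (k * a - N * q) := by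
    have : (c : ℤ) = k * p - n * N := by linarith
    rw [this]; linear_combination (-(k : ℤ)) * ha'
  have hn' : (0 : ℤ) < n := by omega
  have hqn' : (0 : ℤ) ≤ n - q := by omega
  have hcn' : (0 : ℤ) ≤ n - c := by omega
  refine ⟨le_of_eq_add_mul hcq (by positivity) (by omega) hn',
    le_of_eq_add_mul (n := n) (z := q - 1 - (k * a - N * q)) ?_ (by positivity) (by omega) hn',
    le_of_eq_add_mul (n := n) (z := c - 1 - (k * a - N * q)) ?_ (by positivity) (by omega) hn',
    le_of_eq_add_mul (n := n) (z := n - q - c + (k * a - N * q)) ?_ (by positivity) (by omega)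
      hn'⟩
  · linear_combination -hcq
  · linear_combination -hcq
  · linear_combination hcq

/-- The defining inequalities of a type (i) coupling, cleared of the denominator `n`. -/
lemma typeI_bounds {n p q : ℕ} {α g : ℝ} (hn : 2 ≤ n) (htype : TypeI n p q α g) :
    (2 * π / α * p - 2 * π / α / q < n * g ∧ n * g < 2 * π / α * p) ∨
    (2 * π / α * p < n * g ∧ n * g < 2 * π / α * p + 2 * π / α / (n - q)) := by
  obtain ⟨hq1, hqn, -, hg⟩ := htype
  generalize 2 * π / α = T at *
  have hn0 : (0 : ℝ) < n := by positivity
  have hq0 : (0 : ℝ) < q := by positivity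
  have hnq : (0 : ℝ) < (n : ℝ) - q := by
    have : q < n := by omega
    have : (q : ℝ) < n := by exact_mod_cast this
    linarith
  have e0 : n * (T * ((p : ℝ) / n)) = T * p := by field_simp
  have e1 : n * (T * ((p : ℝ) / n - 1 / (n * q))) = T * p - T / q := by field_simp
  have e2 : n * (T * ((p : ℝ) / n + 1 / (n * (n - q)))) = T * p + T / (n - q) := by field_simp
  rcases hg with ⟨h1, h2⟩ | ⟨h1, h2⟩
  · left
    exact ⟨e1 ▸ mul_lt_mul_of_pos_left h1 hn0, e0 ▸ mul_lt_mul_of_pos_left h2 hn0⟩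
  · right
    exact ⟨e0 ▸ mul_lt_mul_of_pos_left h1 hn0, e2 ▸ mul_lt_mul_of_pos_left h2 hn0⟩

/-- The set on which `k g + sgn(M) w`, `0 ≤ w ≤ |M|`, lives avoids the multiples of `2π/α`. -/
lemma typeI_window {n p q k : ℕ} {α g : ℝ} (hn : 2 ≤ n) (hα : 0 < α)
    (hcop : Nat.Coprime p n) (htype : TypeI n p q α g) (hk : 1 ≤ k) (hkn : k < n) {v : ℝ}
    (hv : v ∈ Set.uIcc (k * g) (k * g + (2 * π * p / α - n * g))) :
    (k * p / n : ℕ) * (2 * π / α) < v ∧ v < ((k * p / n : ℕ) + 1) * (2 * π / α) := by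
  have hg := typeI_bounds hn htype
  obtain ⟨hq1, hqn, hpq, -⟩ := htype
  obtain ⟨N, c, hkp, hN, hc1, hcn, b1, b2, b3, b4⟩ := residue_bounds hn hcop hq1 hqn hpq hk hkn
  rw [hN]
  have hM : 2 * π * p / α - n * g = p * (2 * π / α) - n * g := by ring
  rw [hM] at hv
  have hT : 0 < 2 * π / α := by positivity
  generalize 2 * π / α = T at *
  have hn0 : (0 : ℝ) < n := by positivity
  have hq0 : (0 : ℝ) < q := by positivity
  have hnq : (0 : ℝ) < (n : ℝ) - q := by
    have : q < n := by omega
    have : (q : ℝ) < n := by exact_mod_cast this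
    linarith
  have hk0 : (0 : ℝ) < k := by positivity
  have hnk : (0 : ℝ) < (n : ℝ) - k := by
    have : (k : ℝ) < n := by exact_mod_cast hkn
    linarith
  have hc0 : (0 : ℝ) < c := by positivity
  have hnc : (0 : ℝ) < (n : ℝ) - c := by
    have : (c : ℝ) < n := by exact_mod_cast hcn
    linarith
  have hkp' : (k : ℝ) * p = n * N + c := by exact_mod_cast hkp
  have b1' : (k : ℝ) ≤ c * q := by exact_mod_cast b1
  have b2' : (n : ℝ) - k ≤ (n - c) * q := by exact_mod_cast b2
  have b3' : (n : ℝ) - k ≤ c * (n - q) := by exact_mod_cast b3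
  have b4' : (k : ℝ) ≤ (n - c) * (n - q) := by exact_mod_cast b4
  have key : ∀ u : ℝ, N * T < u ∧ u < (N + 1) * T ↔ n * (N * T) < n * u ∧
      n * u < n * ((N + 1) * T) := by
    intro u
    rw [mul_lt_mul_iff_right₀ hn0, mul_lt_mul_iff_right₀ hn0]
  have ends : (N * T < k * g ∧ k * g < (N + 1) * T) ∧
      (N * T < k * g + (p * T - n * g) ∧ k * g + (p * T - n * g) < (N + 1) * T) := by
    have e1 : n * (N * T) = T * (k * p) - T * c := by rw [hkp']; ring
    have e2 : n * ((N + 1) * T) = T * (k * p) + T * (n - c) := by rw [hkp']; ring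
    have e3 : n * (k * g + (p * T - n * g)) = n * p * T - (n - k) * (n * g) := by ring
    have e4 : n * (k * g) = k * (n * g) := by ring
    rw [key, key, e1, e2, e3, e4]
    have tc : 0 < T * c := by positivity
    have tnc : 0 < T * (n - c) := by positivity
    have mk := fun {a b : ℝ} (h : a < b) => mul_lt_mul_of_pos_left h hk0
    have mnk := fun {a b : ℝ} (h : a < b) => mul_lt_mul_of_pos_left h hnk
    rcases hg with ⟨h1', h2'⟩ | ⟨h1', h2'⟩ <;>
      have k1 := mk h1' <;> have k2 := mk h2' <;> have k3 := mnk h1' <;> have k4 := mnk h2'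
    · have c1 : k * (T / q) ≤ T * c := by
        rw [mul_div_assoc', div_le_iff₀ hq0]; linear_combination T * b1'
      have c2 : (n - k) * (T / q) ≤ T * (n - c) := by
        rw [mul_div_assoc', div_le_iff₀ hq0]; linear_combination T * b2'
      refine ⟨⟨?_, ?_⟩, ?_, ?_⟩ <;> linarith
    · have c1 : (n - k) * (T / (n - q)) ≤ T * c := by
        rw [mul_div_assoc', div_le_iff₀ hnq]; linear_combination T * b3'
      have c2 : k * (T / (n - q)) ≤ T * (n - c) := by
        rw [mul_div_assoc', div_le_iff₀ hnq]; linear_combination T * b4'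
      refine ⟨⟨?_, ?_⟩, ?_, ?_⟩ <;> linarith
  rw [Set.mem_uIcc] at hv
  obtain ⟨⟨a1, a2⟩, a3, a4⟩ := ends
  rcases hv with ⟨h1, h2⟩ | ⟨h1, h2⟩ <;> constructor <;> linarith

lemma typeI_abs_lt {n p q : ℕ} {α g : ℝ} (hn : 2 ≤ n) (hα : 0 < α) (htype : TypeI n p q α g) :
    |2 * π * p / α - n * g| < 2 * π / α := by
  have hg := typeI_bounds hn htype
  obtain ⟨hq1, hqn, -, -⟩ := htype
  have hM : 2 * π * p / α - n * g = p * (2 * π / α) - n * g := by ring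
  rw [hM]
  have hT : 0 < 2 * π / α := by positivity
  generalize 2 * π / α = T at *
  have hn0 : (0 : ℝ) < n := by positivity
  have hq0 : (1 : ℝ) ≤ q := by exact_mod_cast hq1
  have hnq : (1 : ℝ) ≤ (n : ℝ) - q := by
    have : q + 1 ≤ n := by omega
    have : (q : ℝ) + 1 ≤ n := by exact_mod_cast this
    linarith
  rw [abs_lt]
  rcases hg with ⟨h1', h2'⟩ | ⟨h1', h2'⟩
  · have : T / q ≤ T := div_le_self hT.le hq0
    constructor <;> linarith
  · have : T / (n - q) ≤ T := div_le_self hT.le hnq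
    constructor <;> linarith

/-- `σ k` is the sign of `sin (α u / 2)` for `u` in the interval spanned by `k g` and `k g + M`
(away from the zero at the end of the interval when `k = 0` or `k = n`). -/
structure SignPattern (n p : ℕ) (α g sg B : ℝ) (σ : ℕ → ℝ) : Prop where
  sq : ∀ k, σ k * σ k = 1
  reflect : ∀ k ≤ n, σ k * σ (n - k) = (-1) ^ (p - 1)
  mid : ∀ k, 1 ≤ k → k < n → ∀ w, 0 ≤ w → w ≤ B → 0 < σ k * hsin α (k * g + sg * w)
  low : ∀ w, 0 < w → w ≤ B → 0 < σ 0 * hsin α (sg * w)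
  high : ∀ w, 0 ≤ w → w < B → 0 < σ n * hsin α (n * g + sg * w)
  high_end : hsin α (n * g + sg * B) = 0

lemma real_sign_mul_self {M : ℝ} (hM : M ≠ 0) : Real.sign M * Real.sign M = 1 := by
  rcases Real.sign_apply_eq_of_ne_zero M hM with h | h <;> rw [h] <;> norm_num

lemma sign_mul_abs_self (M : ℝ) : Real.sign M * |M| = M := by
  rcases lt_trichotomy M 0 with h | h | h
  · rw [Real.sign_of_neg h, abs_of_neg h]; ring
  · simp [h]
  · rw [Real.sign_of_pos h, abs_of_pos h]; ring

lemma hsin_sign_mul {α M : ℝ} (hM : M ≠ 0) (w : ℝ) :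
    hsin α (Real.sign M * w) = Real.sign M * hsin α w := by
  rcases Real.sign_apply_eq_of_ne_zero M hM with h | h <;> rw [h]
  · rw [neg_one_mul, neg_one_mul, hsin_neg]
  · simp

lemma exists_signPattern {n p q : ℕ} {α g : ℝ} (hn : 2 ≤ n) (hα : 0 < α) (hp1 : 1 ≤ p)
    (hcop : Nat.Coprime p n) (htype : TypeI n p q α g) (hM : 2 * π * p / α - n * g ≠ 0) :
    ∃ σ, SignPattern n p α g (Real.sign (2 * π * p / α - n * g)) |2 * π * p / α - n * g| σ := by
  have hlt := typeI_abs_lt hn hα htype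
  have hsB := sign_mul_abs_self (2 * π * p / α - n * g)
  have hss := real_sign_mul_self hM
  have hmul := hsin_sign_mul (α := α) hM
  have hwin := fun k hk hkn v => typeI_window (k := k) (v := v) hn hα hcop htype hk hkn
  have hng : ∀ w, (n : ℝ) * g + Real.sign (2 * π * p / α - n * g) * w =
      -(Real.sign (2 * π * p / α - n * g) * (|2 * π * p / α - n * g| - w)) -
        ((-(p : ℤ) : ℤ) : ℝ) * (2 * π / α) := by
    intro w
    rw [mul_sub, hsB]; push_cast; ring
  have hngS : ∀ w, hsin α ((n : ℝ) * g + Real.sign (2 * π * p / α - n * g) * w) =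
      (-1) ^ (p - 1) * (Real.sign (2 * π * p / α - n * g) *
        hsin α (|2 * π * p / α - n * g| - w)) := by
    intro w
    rw [← hmul, hng]
    have h := hsin_sub_nat α (-(Real.sign (2 * π * p / α - n * g) *
      (|2 * π * p / α - n * g| - w)) - ((-(p : ℤ) : ℤ) : ℝ) * (2 * π / α)) hα p
    rw [show -(Real.sign (2 * π * p / α - n * g) *
      (|2 * π * p / α - n * g| - w)) - ((-(p : ℤ) : ℤ) : ℝ) * (2 * π / α) - p * (2 * π / α) =
      -(Real.sign (2 * π * p / α - n * g) * (|2 * π * p / α - n * g| - w)) by push_cast; ring,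
      hsin_neg] at h
    obtain ⟨m, rfl⟩ : ∃ m, p = m + 1 := ⟨p - 1, by omega⟩
    have hm : ((-1 : ℝ) ^ m) * (-1) ^ m = 1 := by rw [← mul_pow]; simp
    rw [pow_succ] at h
    rw [Nat.add_sub_cancel]
    linear_combination ((-1 : ℝ) ^ m) * h - hm * hsin α (-(Real.sign (2 * π * ((m + 1 : ℕ) : ℝ) / α - n * g) * (|2 * π * ((m + 1 : ℕ) : ℝ) / α - n * g| - w)) - ((-((m + 1 : ℕ) : ℤ) : ℤ) : ℝ) * (2 * π / α))
  generalize hMd : 2 * π * p / α - n * g = M at *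
  generalize hsgd : Real.sign M = sg at *
  have hpp : ((-1 : ℝ) ^ (p - 1)) * (-1) ^ (p - 1) = 1 := by rw [← mul_pow]; simp
  refine ⟨fun k => if k = 0 then sg else if k = n then sg * (-1) ^ (p - 1) else
    (-1) ^ (k * p / n), ?_, ?_, ?_, ?_, ?_, ?_⟩
  · intro k
    split_ifs
    · exact hss
    · linear_combination hss * ((-1 : ℝ) ^ (p - 1)) * (-1) ^ (p - 1) + hpp
    · rw [← mul_pow]; simp
  · intro k hk
    rcases Nat.eq_zero_or_pos k with rfl | hk0
    · rw [if_pos rfl, if_neg (by omega), if_pos (by omega), ← mul_assoc, hss, one_mul]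
    rcases hk.eq_or_lt with rfl | hkn
    · rw [if_neg (by omega), if_pos rfl, if_pos (by omega)]
      linear_combination hss * (-1) ^ (p - 1)
    rw [if_neg (by omega), if_neg (by omega), if_neg (by omega), if_neg (by omega), ← pow_add]
    congr 1
    obtain ⟨N, c, hkp, hN, hc1, hcn, -⟩ :=
      residue_bounds hn hcop htype.1 htype.2.1 htype.2.2.1 hk0 hkn
    have hNp : N + 1 ≤ p := by
      by_contra hcon
      have : p ≤ N := by omega
      have := Nat.mul_le_mul_left n this
      have := Nat.mul_le_mul_right p hkn.le
      omega
    have : (n - k) * p = n * (p - 1 - N) + (n - c) := by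
      zify [hk, hcn.le, hNp, hp1, show N ≤ p - 1 by omega]
      have : (k : ℤ) * p = n * N + c := by exact_mod_cast hkp
      linear_combination -this
    rw [hN, this, Nat.mul_add_div (by omega), Nat.div_eq_of_lt (by omega)]
    omega
  · intro k hk hkn w hw0 hwB
    rw [if_neg (by omega), if_neg (by omega)]
    have := hwin k hk hkn (k * g + sg * w) ?_
    · exact hsin_window_pos hα _ this.1 this.2
    rw [Set.mem_uIcc]
    rcases Real.sign_apply_eq_of_ne_zero M hM with h | h
    · rw [← hsB, ← hsgd, h]; right; constructor <;> linarith
    · rw [← hsB, ← hsgd, h]; left; constructor <;> linarith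
  · intro w hw0 hwB
    rw [if_pos rfl, hmul, ← mul_assoc, hss, one_mul]
    exact hsin_pos hα hw0 (by linarith)
  · intro w hw0 hwB
    rw [if_neg (by omega), if_pos rfl, hngS]
    have := hsin_pos hα (sub_pos.2 hwB) (by linarith)
    calc 0 < hsin α (|M| - w) := this
      _ = _ := by linear_combination (-hpp - hss * ((-1 : ℝ) ^ (p - 1)) * (-1) ^ (p - 1)) *
                    hsin α (|M| - w)
  · rw [hngS]; simp [hsin]

/-- The factor of `Δ_p` attached to a root with `⟨a, ρ_p⟩ = X` and `⟨a, μ⟩ = m`. -/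
def rootWeight (α g sg X : ℝ) (m : ℕ) : ℝ :=
  hsin α (X + sg * m) / hsin α X *
    ∏ l ∈ Finset.range m, hsin α (X + g + sg * l) / hsin α (X - g + sg * (l + 1))

lemma poch_natCast (α z : ℝ) (m : ℕ) :
    poch α z m = ∏ l ∈ Finset.range m, hsin α (z + l) := by
  simp [poch, hsin]

lemma poch_neg_natCast (α z : ℝ) (m : ℕ) :
    poch α z (-m) = 1 / ∏ l ∈ Finset.range m, hsin α (z - (l + 1)) := by
  rcases Nat.eq_zero_or_pos m with rfl | hm
  · simp [poch]
  · have h : ¬ (0 : ℤ) ≤ -m := by omega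
    rw [poch, if_neg h, neg_neg, Int.toNat_natCast]
    congr 1
    have : Finset.Icc 1 m = Finset.Ico 1 (m + 1) := rfl
    rw [this, Finset.prod_Ico_eq_prod_range, Nat.add_sub_cancel]
    refine Finset.prod_congr rfl fun l _ => ?_
    unfold hsin; push_cast; congr 2; ring

lemma rootWeight_eq_poch (α g sg X y : ℝ) (m : ℕ) (hsg : sg = -1 ∨ sg = 1) (hy : y = m) :
    hsin α (X + sg * y) / hsin α X *
      (poch α (X + sg * g) ⌊sg * y⌋ / poch α (X + 1 - sg * g) ⌊sg * y⌋) =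
    rootWeight α g sg X m := by
  subst hy
  unfold rootWeight
  congr 1
  rw [Finset.prod_div_distrib]
  rcases hsg with rfl | rfl
  · have : ⌊(-1 : ℝ) * m⌋ = -(m : ℤ) := by
      rw [Int.floor_eq_iff]; push_cast; constructor <;> linarith
    rw [this, poch_neg_natCast, poch_neg_natCast, one_div, one_div, inv_div_inv]
    congr 1 <;> refine Finset.prod_congr rfl fun l _ => ?_ <;> congr 1 <;> ring
  · have : ⌊(1 : ℝ) * m⌋ = (m : ℤ) := by simp
    rw [this, poch_natCast, poch_natCast]
    congr 1 <;> refine Finset.prod_congr rfl fun l _ => ?_ <;> congr 1 <;> ring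

/-- The ratio of consecutive root weights. -/
lemma rootWeight_succ (α g sg X : ℝ) (m : ℕ)
    (h1 : hsin α (X + sg * m) ≠ 0) (h2 : hsin α (X + sg * (m + 1 : ℕ)) ≠ 0)
    (h3 : hsin α (X + sg * (m + 1 : ℕ) - g) ≠ 0) :
    rootWeight α g sg X (m + 1) *
        (hsin α (X + sg * (m + 1 : ℕ) - g) / hsin α (X + sg * (m + 1 : ℕ))) =
      rootWeight α g sg X m * (hsin α (X + sg * m + g) / hsin α (X + sg * m)) := by
  unfold rootWeight
  rw [Finset.prod_range_succ]
  have e1 : X - g + sg * ((m : ℝ) + 1) = X + sg * (m + 1 : ℕ) - g := by push_cast; ring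
  have e2 : X + g + sg * (m : ℝ) = X + sg * m + g := by ring
  rw [e1, e2]
  generalize (∏ l ∈ Finset.range m, hsin α (X + g + sg * l) / hsin α (X - g + sg * (l + 1))) = P
  field_simp

section
variable {n p : ℕ} {α g sg B : ℝ} {σ : ℕ → ℝ}

lemma SignPattern.pos_of_lt (h : SignPattern n p α g sg B σ) {k : ℕ} (hk : 1 ≤ k) (hkn : k ≤ n)
    {w : ℝ} (hw : 0 ≤ w) (hwB : w < B) : 0 < σ k * hsin α (k * g + sg * w) := by
  rcases hkn.lt_or_eq with hlt | rfl
  · exact h.mid k hk hlt w hw hwB.le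
  · exact h.high w hw hwB

lemma SignPattern.pos_of_pos (h : SignPattern n p α g sg B σ) {k : ℕ} (hkn : k < n)
    {w : ℝ} (hw : 0 < w) (hwB : w ≤ B) : 0 < σ k * hsin α (k * g + sg * w) := by
  rcases Nat.eq_zero_or_pos k with rfl | hk
  · simpa using h.low w hw hwB
  · exact h.mid k hk hkn w hw.le hwB

lemma SignPattern.nonneg (h : SignPattern n p α g sg B σ) {k : ℕ} (hkn : k ≤ n)
    {w : ℝ} (hw : 0 ≤ w) (hwB : w ≤ B) : 0 ≤ σ k * hsin α (k * g + sg * w) := by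
  rcases Nat.eq_zero_or_pos k with rfl | hk
  · rcases hw.eq_or_lt with rfl | hw
    · simp [hsin]
    · simpa using (h.low w hw hwB).le
  · rcases hwB.lt_or_eq with hlt | rfl
    · exact (h.pos_of_lt hk hkn hw hlt).le
    · rcases hkn.lt_or_eq with hlt | rfl
      · exact (h.mid k hk hlt w hw le_rfl).le
      · rw [h.high_end, mul_zero]

/-- The signs `σ (k + 1) σ (k - 1)` are invariant under `k ↦ n - k`. -/
lemma SignPattern.reflect_mul (h : SignPattern n p α g sg B σ) {k : ℕ} (hk : 1 ≤ k)
    (hkn : k < n) : (σ (k + 1) * σ (k - 1)) * (σ (n - k + 1) * σ (n - k - 1)) = 1 := by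
  have h1 := h.reflect (k + 1) (by omega)
  have h2 := h.reflect (k - 1) (by omega)
  rw [show n - (k + 1) = n - k - 1 by omega] at h1
  rw [show n - (k - 1) = n - k + 1 by omega] at h2
  have hpp : ((-1 : ℝ) ^ (p - 1)) * (-1) ^ (p - 1) = 1 := by rw [← mul_pow]; simp
  calc _ = (σ (k + 1) * σ (n - k - 1)) * (σ (k - 1) * σ (n - k + 1)) := by ring
    _ = 1 := by rw [h1, h2, hpp]

lemma SignPattern.middle (h : SignPattern n p α g sg B σ) (hcop : Nat.Coprime p n) {k : ℕ}
    (hk : 1 ≤ k) (hkn : n = k + k) : σ (k + 1) * σ (k - 1) = 1 := by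
  have h1 := h.reflect (k + 1) (by omega)
  rw [show n - (k + 1) = k - 1 by omega] at h1
  have hodd : p % 2 = 1 := by
    by_contra hcon
    have h2p : 2 ∣ p := by omega
    have h2n : 2 ∣ n := by omega
    have := Nat.dvd_gcd h2p h2n
    rw [hcop] at this
    omega
  rw [h1, Even.neg_one_pow]
  rw [Nat.even_iff]; omega

lemma SignPattern.prod_rectangle (h : SignPattern n p α g sg B σ) (hcop : Nat.Coprime p n) (i : ℕ) :
    ∏ x ∈ Finset.range (i + 1) ×ˢ Finset.Ico (i + 1) n,
      σ (x.2 - x.1 + 1) * σ (x.2 - x.1 - 1) = 1 := by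
  refine Finset.prod_involution (fun x _ => (i - x.1, n + i - x.2)) ?_ ?_ ?_ ?_
  · rintro ⟨a, b⟩ hx
    simp only [Finset.mem_product, Finset.mem_range, Finset.mem_Ico] at hx
    have := h.reflect_mul (k := b - a) (by omega) (by omega)
    dsimp only
    rwa [show n + i - b - (i - a) = n - (b - a) by omega]
  · rintro ⟨a, b⟩ hx hne heq
    simp only [Finset.mem_product, Finset.mem_range, Finset.mem_Ico] at hx
    simp only [Prod.mk.injEq] at heq
    exact hne (h.middle hcop (by dsimp only; omega) (by dsimp only; omega))
  · rintro ⟨a, b⟩ hx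
    simp only [Finset.mem_product, Finset.mem_range, Finset.mem_Ico] at hx ⊢
    omega
  · rintro ⟨a, b⟩ hx
    simp only [Finset.mem_product, Finset.mem_range, Finset.mem_Ico] at hx
    simp only [Prod.mk.injEq]
    omega

lemma SignPattern.prod_pairs (h : SignPattern n p α g sg B σ) (hcop : Nat.Coprime p n)
    (w : ℕ → ℕ) :
    ∏ s ∈ Finset.range n, ∏ t ∈ Finset.range n, (if s < t then
      (σ (t - s + 1) * σ (t - s - 1)) ^ (∑ i ∈ Finset.Ico s t, w i) else 1) = 1 := by
  have e1 : ∀ s ∈ Finset.range n, ∀ t ∈ Finset.range n, (if s < t then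
      (σ (t - s + 1) * σ (t - s - 1)) ^ (∑ i ∈ Finset.Ico s t, w i) else 1) =
      ∏ i ∈ Finset.range n, if s ≤ i ∧ i < t then
        (σ (t - s + 1) * σ (t - s - 1)) ^ w i else 1 := by
    intro s _ t ht
    rw [Finset.mem_range] at ht
    rw [← Finset.prod_filter]
    have : (Finset.range n).filter (fun i => s ≤ i ∧ i < t) = Finset.Ico s t := by
      ext i; simp; omega
    rw [this]
    split_ifs with hst
    · rw [Finset.prod_pow_eq_pow_sum]
    · rw [Finset.Ico_eq_empty (by simpa using hst), Finset.prod_empty]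
  rw [Finset.prod_congr rfl fun s hs => (Finset.prod_congr rfl (e1 s hs)).trans Finset.prod_comm,
    Finset.prod_comm]
  refine Finset.prod_eq_one fun i hi => ?_
  rw [Finset.mem_range] at hi
  rw [← Finset.prod_product', ← Finset.prod_filter]
  have : (Finset.range n ×ˢ Finset.range n).filter (fun x => x.1 ≤ i ∧ i < x.2) =
      Finset.range (i + 1) ×ˢ Finset.Ico (i + 1) n := by
    ext x; simp; omega
  rw [this, Finset.prod_pow, h.prod_rectangle hcop, one_pow]

lemma mul_div_eq_of_sq {a b x y : ℝ} (hb : b * b = 1) : a * b * (x / y) = (a * x) / (b * y) := by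
  have hb0 : b ≠ 0 := by rintro rfl; simp at hb
  rcases eq_or_ne y 0 with rfl | hy
  · simp
  · field_simp
    linear_combination (a * x) * hb

lemma SignPattern.rootWeight_pos (h : SignPattern n p α g sg B σ) (hα : 0 < α) {k : ℕ}
    (hk : 1 ≤ k) (hkn : k < n) (c : ℤ) {m : ℕ} (hm : (m : ℝ) ≤ B) :
    0 < (σ (k + 1) * σ (k - 1)) ^ m *
      rootWeight α g sg (k * g - c * (2 * π / α)) m := by
  obtain ⟨ε, hε, hshift⟩ := hsin_sub_int_sign α hα c
  have hε0 : ε ≠ 0 := by rintro rfl; simp at hε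
  unfold rootWeight
  have e0 : k * g - c * (2 * π / α) + sg * m = (k * g + sg * m) - c * (2 * π / α) := by ring
  have e1 : ∀ l : ℕ, k * g - c * (2 * π / α) + g + sg * l =
      ((k + 1 : ℕ) * g + sg * l) - c * (2 * π / α) := by intro l; push_cast; ring
  have e2 : ∀ l : ℕ, k * g - c * (2 * π / α) - g + sg * (l + 1) =
      ((k - 1 : ℕ) * g + sg * (l + 1 : ℕ)) - c * (2 * π / α) := by
    intro l; rw [Nat.cast_sub hk]; push_cast; ring
  simp_rw [e1, e2]
  rw [e0]
  simp_rw [hshift, mul_div_mul_left _ _ hε0]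
  rw [mul_left_comm]
  apply mul_pos
  · have h1 := h.mid k hk hkn m (Nat.cast_nonneg m) hm
    have h2 := h.mid k hk hkn 0 le_rfl ((Nat.cast_nonneg m).trans hm)
    rw [mul_zero, add_zero] at h2
    rw [← one_mul (_ / _), ← h.sq k, mul_div_eq_of_sq (h.sq k)]
    exact div_pos h1 h2
  · have : (σ (k + 1) * σ (k - 1)) ^ m = ∏ _l ∈ Finset.range m, σ (k + 1) * σ (k - 1) := by simp
    rw [this, ← Finset.prod_mul_distrib]
    refine Finset.prod_pos fun l hl => ?_
    rw [Finset.mem_range] at hl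
    have hlm : ((l + 1 : ℕ) : ℝ) ≤ B := le_trans (by exact_mod_cast hl) hm
    rw [mul_div_eq_of_sq (h.sq _)]
    refine div_pos (h.pos_of_lt (by omega) (by omega) (by positivity) ?_)
      (h.pos_of_pos (by omega) (by positivity) hlm)
    push_cast at hlm
    linarith
end

lemma inn_ee {n j : ℕ} (i : Fin n) (h : ((i : ℕ) + 1) % n = j % n) (x : Fin n → ℝ) :
    inn (ee n j) x = x i := by
  have : ∀ i' : Fin n, (((i' : ℕ) + 1) % n = j % n) ↔ i' = i := by
    intro i'
    rw [← h]
    constructor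
    · intro he
      have : (i' : ℕ) ≡ i [MOD n] := Nat.ModEq.add_right_cancel' 1 he
      exact Fin.ext (Nat.ModEq.eq_of_lt_of_lt this i'.2 i.2)
    · rintro rfl; rfl
  simp [inn, ee, this]

lemma inn_sub_left {n : ℕ} (a b x : Fin n → ℝ) : inn (a - b) x = inn a x - inn b x := by
  simp [inn, sub_mul]

lemma inn_add_right {n : ℕ} (a x y : Fin n → ℝ) : inn a (x + y) = inn a x + inn a y := by
  simp [inn, mul_add, Finset.sum_add_distrib]

lemma inn_smul_left {n : ℕ} (c : ℝ) (a x : Fin n → ℝ) : inn (c • a) x = c * inn a x := by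
  simp [inn, Finset.mul_sum, mul_assoc]

lemma inn_smul_right {n : ℕ} (c : ℝ) (a x : Fin n → ℝ) : inn a (c • x) = c * inn a x := by
  simp [inn, Finset.mul_sum, mul_left_comm]

lemma inn_sum_left {n : ℕ} {ι : Type*} (s : Finset ι) (f : ι → Fin n → ℝ) (x : Fin n → ℝ) :
    inn (∑ i ∈ s, f i) x = ∑ i ∈ s, inn (f i) x := by
  simp only [inn, Finset.sum_apply, Finset.sum_mul]
  exact Finset.sum_comm

lemma inn_sum_right {n : ℕ} {ι : Type*} (s : Finset ι) (f : ι → Fin n → ℝ) (x : Fin n → ℝ) :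
    inn x (∑ i ∈ s, f i) = ∑ i ∈ s, inn x (f i) := by
  simp only [inn, Finset.sum_apply, Finset.mul_sum]
  exact Finset.sum_comm

lemma inn_ee_sub_ee {n : ℕ} (i j : Fin n) (x : Fin n → ℝ) :
    inn (ee n (i + 1) - ee n (j + 1)) x = x i - x j := by
  rw [inn_sub_left, inn_ee i rfl, inn_ee j rfl]

/-- The (zero-based) coordinate `(t + 1) p` modulo `n`: the order in which the simple roots
`a_{j,p}` connect the coordinates. -/
def chain {n : ℕ} (p : ℕ) (hn : 0 < n) (t : ℕ) : Fin n := ⟨((t + 1) * p - 1) % n, Nat.mod_lt _ hn⟩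

section
variable {n p : ℕ} (hn : 0 < n)

lemma chain_add_one_mod (hp : 1 ≤ p) (t : ℕ) :
    ((chain p hn t : ℕ) + 1) % n = ((t + 1) * p) % n := by
  have : 1 ≤ (t + 1) * p := Nat.mul_pos (by omega) hp
  simp only [chain]
  rw [Nat.mod_add_mod, Nat.sub_add_cancel this]

lemma eq_of_mul_mod_eq (hcop : Nat.Coprime p n) {s t : ℕ} (hs : s < n) (ht : t < n)
    (h : ((s + 1) * p) % n = ((t + 1) * p) % n) : s = t := by
  have h1 : s + 1 ≡ t + 1 [MOD n] := Nat.ModEq.cancel_right_of_coprime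
    (by rw [Nat.gcd_comm]; exact hcop) h
  exact Nat.ModEq.eq_of_lt_of_lt (Nat.ModEq.add_right_cancel' 1 h1) hs ht

lemma chain_inj (hp : 1 ≤ p) (hcop : Nat.Coprime p n) {s t : ℕ} (hs : s < n) (ht : t < n)
    (h : chain p hn s = chain p hn t) : s = t := by
  apply eq_of_mul_mod_eq hcop hs ht
  rw [← chain_add_one_mod hn hp, ← chain_add_one_mod hn hp, h]

lemma prod_Icc_eq_prod_chain (hp : 1 ≤ p) (hcop : Nat.Coprime p n) (f : ℕ → ℝ) :
    ∏ j ∈ Icc 1 n, f j = ∏ s ∈ Finset.range n, f (chain p hn s + 1) := by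
  symm
  have hinj : Set.InjOn (fun s => (chain p hn s : ℕ) + 1) (Finset.range n) := by
    intro s hs t ht h
    simp only [Finset.coe_range, Set.mem_Iio] at hs ht
    exact chain_inj hn hp hcop hs ht (Fin.ext (by simpa using h))
  have himg : (Finset.range n).image (fun s => (chain p hn s : ℕ) + 1) = Icc 1 n := by
    apply Finset.eq_of_subset_of_card_le
    · intro j hj
      obtain ⟨s, -, rfl⟩ := Finset.mem_image.1 hj
      simp
    · rw [Finset.card_image_of_injOn hinj]; simp
  rw [← himg, Finset.prod_image hinj]

lemma prod_range_eq_prod_lt (N : ℕ) (f : ℕ → ℕ → ℝ) (hf : ∀ s, f s s = 1) :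
    ∏ s ∈ Finset.range N, ∏ t ∈ Finset.range N, f s t =
      ∏ s ∈ Finset.range N, ∏ t ∈ Finset.range N, if s < t then f s t * f t s else 1 := by
  have e : ∀ s t, f s t = (if s < t then f s t else 1) * (if t < s then f s t else 1) := by
    intro s t
    rcases lt_trichotomy s t with h | rfl | h
    · simp [h, h.not_gt]
    · simp [hf]
    · simp [h, h.not_gt]
  have e' : ∀ s t, (if s < t then f s t * f t s else 1) =
      (if s < t then f s t else 1) * (if s < t then f t s else 1) := by
    intro s t; split_ifs <;> simp
  simp_rw [e']
  rw [Finset.prod_congr rfl fun s _ => Finset.prod_congr rfl fun t _ => e s t]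
  simp_rw [Finset.prod_mul_distrib]
  congr 1
  exact Finset.prod_comm

lemma inn_aa_chain (hp : 1 ≤ p) (t : ℕ) (v : Fin n → ℝ) :
    inn (aa n p (((t + 1) * p) % n)) v = v (chain p hn t) - v (chain p hn (t + 1)) := by
  unfold aa
  rw [inn_sub_left, inn_ee (chain p hn t), inn_ee (chain p hn (t + 1))]
  · rw [chain_add_one_mod hn hp, Nat.mod_add_mod]; congr 1; ring
  · rw [chain_add_one_mod hn hp, Nat.mod_mod]

lemma aa_chain (hp : 1 ≤ p) (t : ℕ) : aa n p (((t + 1) * p) % n) =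
    ee n (chain p hn t + 1) - ee n (chain p hn (t + 1) + 1) := by
  ext i
  unfold aa ee
  simp only [Pi.sub_apply]
  rw [chain_add_one_mod hn hp, chain_add_one_mod hn hp, Nat.mod_mod, Nat.mod_add_mod]
  congr 4
  ring

lemma mul_mod_mem (hn : 0 < n) (hcop : Nat.Coprime p n) {t : ℕ} (ht : t + 1 < n) :
    1 ≤ ((t + 1) * p) % n ∧ ((t + 1) * p) % n ≤ n - 1 := by
  constructor
  · by_contra hc
    have hdvd : n ∣ (t + 1) * p := Nat.dvd_of_mod_eq_zero (by omega)
    have := Nat.le_of_dvd (by omega) ((Nat.Coprime.symm hcop).dvd_of_dvd_mul_right hdvd)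
    omega
  · have := Nat.mod_lt ((t + 1) * p) hn
    omega

/-- Differences along the chain telescope. -/
lemma chain_sub_eq_sum (v : Fin n → ℝ) {s t : ℕ} (hst : s ≤ t) :
    v (chain p hn s) - v (chain p hn t) =
      ∑ i ∈ Finset.Ico s t, (v (chain p hn i) - v (chain p hn (i + 1))) := by
  induction t, hst using Nat.le_induction with
  | base => simp
  | succ t hst ih => rw [Finset.sum_Ico_succ_top hst, ← ih]; ring

variable {ω : ℕ → Fin n → ℝ}

lemma inn_aa_weight
    (hωδ : ∀ j : ℕ, 1 ≤ j → j ≤ n - 1 → ∀ k : ℕ, 1 ≤ k → k ≤ n - 1 →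
      inn (aa n p j) (ω k) = if j = k then (1 : ℝ) else 0)
    (m : ℕ → ℝ) {j : ℕ} (hj1 : 1 ≤ j) (hjn : j ≤ n - 1) :
    inn (aa n p j) (∑ k ∈ Icc 1 (n - 1), m k • ω k) = m j := by
  rw [inn_sum_right, Finset.sum_eq_single j]
  · rw [inn_smul_right, hωδ j hj1 hjn j hj1 hjn]; simp
  · intro k hk hne
    rw [Finset.mem_Icc] at hk
    rw [inn_smul_right, hωδ j hj1 hjn k hk.1 hk.2, if_neg hne.symm, mul_zero]
  · intro h; exact absurd (Finset.mem_Icc.2 ⟨hj1, hjn⟩) h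

/-- The pairings of a dominant weight with the positive roots. -/
lemma exists_chain_weights (hp : 1 ≤ p) (hcop : Nat.Coprime p n)
    (hωδ : ∀ j : ℕ, 1 ≤ j → j ≤ n - 1 → ∀ k : ℕ, 1 ≤ k → k ≤ n - 1 →
      inn (aa n p j) (ω k) = if j = k then (1 : ℝ) else 0)
    {B : ℝ} {μ : Fin n → ℝ} (hμ : μ ∈ Lam n B ω) :
    ∃ w : ℕ → ℕ, ∀ s t : ℕ, s < t → t < n →
      μ (chain p hn s) - μ (chain p hn t) = ((∑ i ∈ Finset.Ico s t, w i : ℕ) : ℝ) ∧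
      ((∑ i ∈ Finset.Ico s t, w i : ℕ) : ℝ) ≤ B := by
  obtain ⟨m, hm, rfl⟩ := hμ
  refine ⟨fun i => m (((i + 1) * p) % n), fun s t hst htn => ⟨?_, le_trans ?_ hm⟩⟩
  · rw [chain_sub_eq_sum hn _ hst.le]
    push_cast
    refine Finset.sum_congr rfl fun i hi => ?_
    rw [Finset.mem_Ico] at hi
    obtain ⟨h1, h2⟩ := mul_mod_mem hn hcop (t := i) (by omega)
    rw [← inn_aa_chain hn hp, inn_aa_weight hωδ (fun j => (m j : ℝ)) h1 h2]
  · have hinj : Set.InjOn (fun i => ((i + 1) * p) % n) (Finset.Ico s t) := by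
      intro i hi j hj h
      simp only [Finset.coe_Ico, Set.mem_Ico] at hi hj
      exact eq_of_mul_mod_eq hcop (by omega) (by omega) h
    push_cast
    rw [← Finset.sum_image (f := fun j => (m j : ℝ)) hinj]
    refine Finset.sum_le_sum_of_subset_of_nonneg ?_ fun _ _ _ => by positivity
    intro j hj
    obtain ⟨i, hi, rfl⟩ := Finset.mem_image.1 hj
    rw [Finset.mem_Ico] at hi
    exact Finset.mem_Icc.2 (mul_mod_mem hn hcop (by omega))

lemma rhoP_eq_sum {α g : ℝ} (hp1 : 1 ≤ p) :
    rhoP n p α g ω =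
      ∑ j ∈ Icc 1 (n - 1), (g - if j ≤ n - p then 0 else 2 * π / α) • ω j := by
  unfold rhoP
  rw [Finset.smul_sum, Finset.smul_sum]
  have hu : Icc 1 (n - 1) = Icc 1 (n - p) ∪ Icc (n - p + 1) (n - 1) := by
    ext j; simp; omega
  rw [hu, Finset.sum_union]
  · congr 1 <;> refine Finset.sum_congr rfl fun j hj => ?_ <;> rw [Finset.mem_Icc] at hj
    · rw [if_pos hj.2, sub_zero]
    · rw [if_neg (by omega)]
  · rw [Finset.disjoint_left]
    intro j h1 h2
    rw [Finset.mem_Icc] at h1 h2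
    omega

/-- The number of windings of the chain up to position `t`. -/
def winding (n p t : ℕ) : ℤ := (((t + 1) * p - 1) / n : ℕ)

lemma rhoP_chain_sub {α g : ℝ} (hp1 : 1 ≤ p) (hpn : p ≤ n - 1) (hcop : Nat.Coprime p n)
    (hωδ : ∀ j : ℕ, 1 ≤ j → j ≤ n - 1 → ∀ k : ℕ, 1 ≤ k → k ≤ n - 1 →
      inn (aa n p j) (ω k) = if j = k then (1 : ℝ) else 0)
    {s t : ℕ} (hst : s ≤ t) (ht : t < n) :
    rhoP n p α g ω (chain p hn s) - rhoP n p α g ω (chain p hn t) =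
      ((t - s : ℕ) : ℝ) * g - (winding n p t - winding n p s : ℤ) * (2 * π / α) := by
  induction t, hst using Nat.le_induction with
  | base => simp
  | succ t hst ih =>
    have ih' := ih (by omega)
    have hstep : rhoP n p α g ω (chain p hn t) - rhoP n p α g ω (chain p hn (t + 1)) =
        g - (winding n p (t + 1) - winding n p t : ℤ) * (2 * π / α) := by
      obtain ⟨h1, h2⟩ := mul_mod_mem hn hcop ht
      rw [← inn_aa_chain hn hp1, rhoP_eq_sum hp1,
        inn_aa_weight hωδ (fun j => g - if j ≤ n - p then 0 else 2 * π / α) h1 h2]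
      congr 1
      have hd := Nat.div_add_mod ((t + 1) * p) n
      have e2 : (t + 1 + 1) * p = (t + 1) * p + p := by ring
      unfold winding
      rw [e2]
      generalize (t + 1) * p = y at *
      generalize y % n = j at *
      generalize y / n = a at *
      subst hd
      rw [show n * a + j - 1 = n * a + (j - 1) by omega, Nat.mul_add_div hn,
        Nat.div_eq_of_lt (show j - 1 < n by omega)]
      split_ifs with hj
      · rw [show n * a + j + p - 1 = n * a + (j + p - 1) by omega, Nat.mul_add_div hn,
          Nat.div_eq_of_lt (show j + p - 1 < n by omega)]
        simp
      · rw [show n * a + j + p - 1 = n * (a + 1) + (j + p - 1 - n) by rw [mul_add]; omega,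
          Nat.mul_add_div hn, Nat.div_eq_of_lt (show j + p - 1 - n < n by omega)]
        simp
    rw [Nat.sub_add_comm hst]
    push_cast at *
    linear_combination ih' + hstep

lemma exists_nat_comb (hp : 1 ≤ p) (hcop : Nat.Coprime p n) {s t : ℕ} (hst : s ≤ t)
    (ht : t < n) :
    ∃ c : ℕ → ℕ, ee n (chain p hn s + 1) - ee n (chain p hn t + 1) =
      ∑ j ∈ Icc 1 (n - 1), (c j : ℝ) • aa n p j := by
  induction t, hst using Nat.le_induction with
  | base => exact ⟨0, by simp⟩
  | succ t hst ih =>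
    obtain ⟨c, hc⟩ := ih (by omega)
    have hmem := Finset.mem_Icc.2 (mul_mod_mem hn hcop ht)
    refine ⟨fun j => c j + if j = ((t + 1) * p) % n then 1 else 0, ?_⟩
    have e : ee n (chain p hn s + 1) - ee n (chain p hn (t + 1) + 1) =
        (ee n (chain p hn s + 1) - ee n (chain p hn t + 1)) + aa n p (((t + 1) * p) % n) := by
      rw [aa_chain hn hp]; abel
    rw [e, hc]
    push_cast
    simp_rw [add_smul]
    rw [Finset.sum_add_distrib]
    congr 1
    simp only [ite_smul, one_smul, zero_smul]
    rw [Finset.sum_ite_eq' (Icc 1 (n - 1)) (((t + 1) * p) % n) (fun j => aa n p j), if_pos hmem]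

lemma inPosRoots_chain_iff (hp : 1 ≤ p) (hcop : Nat.Coprime p n)
    (hωδ : ∀ j : ℕ, 1 ≤ j → j ≤ n - 1 → ∀ k : ℕ, 1 ≤ k → k ≤ n - 1 →
      inn (aa n p j) (ω k) = if j = k then (1 : ℝ) else 0)
    {s t : ℕ} (hs : s < n) (ht : t < n) :
    inPosRoots n p (ee n (chain p hn s + 1) - ee n (chain p hn t + 1)) ↔ s < t := by
  constructor
  · rintro ⟨⟨j, hj, k, hk, hjk, hv⟩, c, hc⟩
    by_contra hst
    rw [not_lt] at hst
    rcases hst.eq_or_lt with rfl | hlt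
    · rw [Finset.mem_Icc] at hj hk
      rw [sub_self] at hv
      have h1 : inn (ee n j - ee n k) (fun i => ((i : ℕ) : ℝ)) = (j - 1 : ℕ) - (k - 1 : ℕ) := by
        have := inn_ee_sub_ee (n := n) ⟨j - 1, by omega⟩ ⟨k - 1, by omega⟩
          (fun i => ((i : ℕ) : ℝ))
        simpa [Nat.sub_add_cancel hj.1, Nat.sub_add_cancel hk.1] using this
      rw [← hv] at h1
      have h2 : ((j - 1 : ℕ) : ℝ) = (k - 1 : ℕ) := by
        have : inn (0 : Fin n → ℝ) (fun i => ((i : ℕ) : ℝ)) = 0 := by simp [inn]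
        linarith
      have h3 : j - 1 = k - 1 := by exact_mod_cast h2
      omega
    · have hL : ∀ j, 1 ≤ j → j ≤ n - 1 →
          inn (aa n p j) (∑ k ∈ Icc 1 (n - 1), (1 : ℝ) • ω k) = 1 :=
        fun j h1 h2 => inn_aa_weight hωδ (fun _ => 1) h1 h2
      generalize (∑ k ∈ Icc 1 (n - 1), (1 : ℝ) • ω k) = L at hL
      have h1 : 0 ≤ inn (ee n (chain p hn s + 1) - ee n (chain p hn t + 1)) L := by
        rw [hc, inn_sum_left]
        refine Finset.sum_nonneg fun j hj => ?_
        rw [Finset.mem_Icc] at hj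
        rw [inn_smul_left, hL j hj.1 hj.2]
        positivity
      rw [inn_ee_sub_ee] at h1
      have h2 := chain_sub_eq_sum (p := p) hn L hlt.le
      have h3 : ∑ i ∈ Finset.Ico t s, (L (chain p hn i) - L (chain p hn (i + 1))) =
          ∑ i ∈ Finset.Ico t s, (1 : ℝ) := by
        refine Finset.sum_congr rfl fun i hi => ?_
        rw [Finset.mem_Ico] at hi
        obtain ⟨a1, a2⟩ := mul_mod_mem hn hcop (t := i) (by omega)
        rw [← inn_aa_chain hn hp, hL _ a1 a2]
      rw [h3] at h2
      simp only [Finset.sum_const, Nat.card_Ico, nsmul_eq_mul, mul_one] at h2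
      have h4 : (0 : ℝ) < (s - t : ℕ) := by
        have : 0 < s - t := by omega
        exact_mod_cast this
      linarith
  · intro hst
    refine ⟨⟨_, ?_, _, ?_, ?_, rfl⟩, exists_nat_comb hn hp hcop hst.le ht⟩
    · have := (chain p hn s).2; rw [Finset.mem_Icc]; omega
    · have := (chain p hn t).2; rw [Finset.mem_Icc]; omega
    · intro h
      have := chain_inj hn hp hcop hs ht (Fin.ext (by omega))
      omega

/-- The barycentre of the simplex. -/
def simplexCenter (n : ℕ) (α : ℝ) : Fin n → ℝ :=
  fun i => (2 * π / α) * (((n : ℝ) - 1) / (2 * n) - (i : ℕ) / n)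

lemma coord_simplexCenter (hn : 0 < n) (α : ℝ) {j : ℕ} :
    coord α (simplexCenter n α) j =
      (2 * π / α) * (((n : ℝ) - 1) / (2 * n) - ((j - 1 : ℕ) : ℝ) / n) := by
  unfold coord
  rw [dif_pos hn]
  simp only [simplexCenter]
  have hd : (n : ℝ) * ((j - 1) / n : ℕ) + ((j - 1) % n : ℕ) = (j - 1 : ℕ) := by
    exact_mod_cast Nat.div_add_mod (j - 1) n
  have hn0 : (n : ℝ) ≠ 0 := by positivity
  rw [← hd]
  generalize 2 * π / α = T
  field_simp
  ring

lemma simplexCenter_mem {α g : ℝ} (hn : 0 < n) (hM : 2 * π * p / α - n * g ≠ 0) :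
    simplexCenter n α ∈ SigmaInt n p α g := by
  have hn0 : (n : ℝ) ≠ 0 := by positivity
  constructor
  · simp only [simplexCenter]
    rw [← Finset.mul_sum, Finset.sum_sub_distrib, ← Finset.sum_div Finset.univ fun i : Fin n => ((i : ℕ) : ℝ)]
    have hsum : ∑ i : Fin n, ((i : ℕ) : ℝ) = n * (n - 1) / 2 := by
      rw [Fin.sum_univ_eq_sum_range (fun i => (i : ℝ)) n, eq_div_iff two_ne_zero]
      have := Finset.sum_range_id_mul_two n
      have h2 : ((∑ i ∈ Finset.range n, i : ℕ) : ℝ) * 2 = n * ((n - 1 : ℕ) : ℝ) := by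
        exact_mod_cast this
      rw [Nat.cast_sub hn] at h2
      push_cast at h2
      exact h2
    rw [hsum]
    simp only [Finset.sum_const, Finset.card_univ, Fintype.card_fin, nsmul_eq_mul]
    rw [show (n : ℝ) * ((n - 1) / (2 * n)) - n * (n - 1) / 2 / n = 0 by field_simp; ring, mul_zero]
  · intro j hj
    rw [Finset.mem_Icc] at hj
    rw [coord_simplexCenter hn, coord_simplexCenter hn, Nat.cast_sub hj.1,
      Nat.cast_sub (by omega : 1 ≤ j + p)]
    push_cast
    have e : 2 * π / α * (((n : ℝ) - 1) / (2 * n) - ((j : ℝ) - 1) / n) -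
        2 * π / α * (((n : ℝ) - 1) / (2 * n) - ((j : ℝ) + p - 1) / n) - g =
        (2 * π * p / α - n * g) / n := by
      field_simp
      ring
    rw [e, mul_div_assoc']
    apply div_pos _ (by positivity)
    rw [← sign_mul_abs_self (2 * π * p / α - n * g), ← mul_assoc, sign_mul_abs_self,
      real_sign_mul_self hM, one_mul]
    exact abs_pos.2 hM

lemma simplexCenter_chain_sub {α g : ℝ} (hp : 1 ≤ p) {s t : ℕ} (hst : s ≤ t) :
    simplexCenter n α (chain p hn s) - simplexCenter n α (chain p hn t) =
      ((t - s : ℕ) : ℝ) * g - (winding n p t - winding n p s : ℤ) * (2 * π / α) +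
        Real.sign (2 * π * p / α - n * g) *
          (|2 * π * p / α - n * g| * ((t - s : ℕ) / n)) := by
  have hc : ∀ t : ℕ, simplexCenter n α (chain p hn t) =
      (2 * π / α) * (((n : ℝ) - 1) / (2 * n) - ((((t + 1) * p - 1 : ℕ) : ℝ) / n)) +
        (2 * π / α) * winding n p t := by
    intro t
    have h := coord_simplexCenter hn α (j := (t + 1) * p)
    unfold coord at h
    rw [dif_pos hn] at h
    unfold winding chain
    rw [← h, Int.cast_natCast, sub_add_cancel]
  have hn0 : (n : ℝ) ≠ 0 := by positivity
  have h1 : ∀ t : ℕ, 1 ≤ (t + 1) * p := fun t => Nat.mul_pos (by omega) hp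
  rw [← mul_assoc, sign_mul_abs_self, hc, hc, Nat.cast_sub (h1 _), Nat.cast_sub (h1 _),
    Nat.cast_sub hst]
  rw [show 2 * π * p / α = p * (2 * π / α) by ring]
  generalize 2 * π / α = T
  push_cast
  field_simp
  ring
end

/-- The contribution to `V_ν` of a pair of opposite roots `± a` with `⟨a, ν⟩ = δ`,
`⟨a, x⟩ = U`. -/
def pairFactor (α g δ U : ℝ) : ℝ :=
  if δ = 1 then hsin α (U + g) / hsin α U
  else if δ = -1 then hsin α (U - g) / hsin α U else 1

lemma pairFactor_neg (α g δ U : ℝ) : pairFactor α g δ (-U) = pairFactor α g (-δ) U := by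
  have h1 : hsin α (-U + g) / hsin α (-U) = hsin α (U - g) / hsin α U := by
    rw [show -U + g = -(U - g) by ring, hsin_neg, hsin_neg, neg_div_neg_eq]
  have h2 : hsin α (-U - g) / hsin α (-U) = hsin α (U + g) / hsin α U := by
    rw [show -U - g = -(U + g) by ring, hsin_neg, hsin_neg, neg_div_neg_eq]
  unfold pairFactor
  rw [h1, h2]
  rcases eq_or_ne δ 1 with rfl | hd1
  · norm_num
  rcases eq_or_ne δ (-1) with rfl | hd2
  · norm_num
  rw [if_neg hd1, if_neg hd2, if_neg (fun h => hd2 (by linarith)),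
    if_neg (fun h => hd1 (by linarith))]

/-- The sign of `pairFactor` prescribed by a sign pattern. -/
def pairSign (σ : ℕ → ℝ) (δ : ℝ) (k : ℕ) : ℝ :=
  if δ = 1 then σ (k + 1) * σ k else if δ = -1 then σ (k - 1) * σ k else 1

section
variable {n p : ℕ} {α g sg B : ℝ} {σ : ℕ → ℝ}

lemma SignPattern.ne_zero (h : SignPattern n p α g sg B σ) (hα : 0 < α) {k : ℕ}
    (hk : 1 ≤ k) (hkn : k < n) (c : ℤ) {w : ℝ} (hw : 0 ≤ w) (hwB : w ≤ B) :
    hsin α (k * g - c * (2 * π / α) + sg * w) ≠ 0 := by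
  obtain ⟨ε, hε, hshift⟩ := hsin_sub_int_sign α hα c
  have hε0 : ε ≠ 0 := by rintro rfl; simp at hε
  rw [show k * g - c * (2 * π / α) + sg * w = k * g + sg * w - c * (2 * π / α) by ring, hshift]
  exact mul_ne_zero hε0 (right_ne_zero_of_mul (h.mid k hk hkn w hw hwB).ne')

lemma SignPattern.pred_ne_zero (h : SignPattern n p α g sg B σ) (hα : 0 < α) {k : ℕ}
    (hk : 1 ≤ k) (hkn : k < n) (c : ℤ) {w : ℝ} (hw : 0 < w) (hwB : w ≤ B) :
    hsin α (k * g - c * (2 * π / α) + sg * w - g) ≠ 0 := by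
  obtain ⟨ε, hε, hshift⟩ := hsin_sub_int_sign α hα c
  have hε0 : ε ≠ 0 := by rintro rfl; simp at hε
  rw [show k * g - c * (2 * π / α) + sg * w - g =
    (k - 1 : ℕ) * g + sg * w - c * (2 * π / α) by rw [Nat.cast_sub hk]; push_cast; ring, hshift]
  exact mul_ne_zero hε0
    (right_ne_zero_of_mul (h.pos_of_pos (k := k - 1) (by omega) hw hwB).ne')

lemma SignPattern.pairSign_mul (h : SignPattern n p α g sg B σ) (hα : 0 < α) {k : ℕ}
    (hk : 1 ≤ k) (hkn : k < n) (c : ℤ) (δ : ℝ) {w : ℝ} (hw : 0 ≤ w) (hwB : w ≤ B) :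
    0 ≤ pairSign σ δ k * pairFactor α g δ (k * g - c * (2 * π / α) + sg * w) ∧
    (0 < w → w < B →
      0 < pairSign σ δ k * pairFactor α g δ (k * g - c * (2 * π / α) + sg * w)) := by
  obtain ⟨ε, hε, hshift⟩ := hsin_sub_int_sign α hα c
  have hε0 : ε ≠ 0 := by rintro rfl; simp at hε
  have hmid := h.mid k hk hkn w hw hwB
  have e0 : k * g - c * (2 * π / α) + sg * w = k * g + sg * w - c * (2 * π / α) := by ring
  have e1 : k * g - c * (2 * π / α) + sg * w + g =
    (k + 1 : ℕ) * g + sg * w - c * (2 * π / α) := by push_cast; ring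
  have e2 : k * g - c * (2 * π / α) + sg * w - g =
    (k - 1 : ℕ) * g + sg * w - c * (2 * π / α) := by rw [Nat.cast_sub hk]; push_cast; ring
  unfold pairSign pairFactor
  rw [e1, e2, e0, hshift, hshift, hshift, mul_div_mul_left _ _ hε0, mul_div_mul_left _ _ hε0]
  split_ifs
  · rw [mul_div_eq_of_sq (h.sq k)]
    exact ⟨div_nonneg (h.nonneg (by omega) hw hwB) hmid.le,
      fun _ h2 => div_pos (h.pos_of_lt (by omega) (by omega) hw h2) hmid⟩
  · rw [mul_div_eq_of_sq (h.sq k)]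
    exact ⟨div_nonneg (h.nonneg (by omega) hw hwB) hmid.le,
      fun h1 _ => div_pos (h.pos_of_pos (by omega) h1 hwB) hmid⟩
  · simp

/-- The detailed balance relation between the lattice weights and the coefficients, for a
single pair of opposite roots. -/
lemma SignPattern.rootWeight_balance (h : SignPattern n p α g sg B σ) (hα : 0 < α) {k : ℕ}
    (hk : 1 ≤ k) (hkn : k < n) (c : ℤ) {δ : ℝ} (hδ : δ = 1 ∨ δ = -1 ∨ δ = 0) {m m' : ℕ}
    (hm : (m : ℝ) ≤ B) (hm' : (m' : ℝ) ≤ B) (hmm : (m' : ℝ) = m + δ) :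
    rootWeight α g sg (k * g - c * (2 * π / α)) m' *
        pairFactor α g (-δ) (k * g - c * (2 * π / α) + sg * m') =
      rootWeight α g sg (k * g - c * (2 * π / α)) m *
        pairFactor α g δ (k * g - c * (2 * π / α) + sg * m) := by
  have key : ∀ j : ℕ, ((j + 1 : ℕ) : ℝ) ≤ B →
      rootWeight α g sg (k * g - c * (2 * π / α)) (j + 1) *
        (hsin α (k * g - c * (2 * π / α) + sg * (j + 1 : ℕ) - g) /
          hsin α (k * g - c * (2 * π / α) + sg * (j + 1 : ℕ))) =
      rootWeight α g sg (k * g - c * (2 * π / α)) j *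
        (hsin α (k * g - c * (2 * π / α) + sg * j + g) /
          hsin α (k * g - c * (2 * π / α) + sg * j)) := by
    intro j hj
    have hj' : (j : ℝ) ≤ B := by push_cast at hj; linarith
    exact rootWeight_succ _ _ _ _ _ (h.ne_zero hα hk hkn c (by positivity) hj')
      (h.ne_zero hα hk hkn c (by positivity) hj) (h.pred_ne_zero hα hk hkn c (by positivity) hj)
  rcases hδ with rfl | rfl | rfl
  · have : m' = m + 1 := by exact_mod_cast hmm
    subst this
    have := key m hm'
    unfold pairFactor
    norm_num at this ⊢
    exact this
  · have : m = m' + 1 := by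
      have : (m : ℝ) = (m' + 1 : ℕ) := by push_cast; linarith
      exact_mod_cast this
    subst this
    have := key m' hm
    unfold pairFactor
    norm_num at this ⊢
    exact this.symm
  · have : m' = m := by rw [add_zero] at hmm; exact_mod_cast hmm
    subst this
    simp [pairFactor]
end

section
variable {n p : ℕ} (hn : 0 < n)

lemma Vnu_eq_prod_pairFactor (hp : 1 ≤ p) (hcop : Nat.Coprime p n) (α g : ℝ)
    (ν x : Fin n → ℝ) :
    Vnu n α g ν x = ∏ s ∈ Finset.range n, ∏ t ∈ Finset.range n, if s < t then
      pairFactor α g (ν (chain p hn s) - ν (chain p hn t)) (x (chain p hn s) - x (chain p hn t))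
      else 1 := by
  unfold Vnu
  simp_rw [prod_Icc_eq_prod_chain hn hp hcop, inn_ee_sub_ee]
  rw [prod_range_eq_prod_lt n (fun s t => if (chain p hn s : ℕ) + 1 ≠ (chain p hn t : ℕ) + 1 ∧
    ν (chain p hn s) - ν (chain p hn t) = 1 then
      Real.sin (α * (x (chain p hn s) - x (chain p hn t) + g) / 2) /
        Real.sin (α * (x (chain p hn s) - x (chain p hn t)) / 2) else 1)
    (fun s => if_neg (by simp))]
  refine Finset.prod_congr rfl fun s hs => Finset.prod_congr rfl fun t ht => ?_
  rw [Finset.mem_range] at hs ht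
  by_cases hst : s < t
  · rw [if_pos hst, if_pos hst]
    have hne : (chain p hn s : ℕ) + 1 ≠ (chain p hn t : ℕ) + 1 := fun h =>
      hst.ne (chain_inj hn hp hcop hs ht (Fin.ext (by omega)))
    simp only [hne, hne.symm, ne_eq, not_false_eq_true, true_and]
    have e1 : ν (chain p hn t) - ν (chain p hn s) = 1 ↔
        ν (chain p hn s) - ν (chain p hn t) = -1 := by constructor <;> intro h <;> linarith
    have e2 : Real.sin (α * (x (chain p hn t) - x (chain p hn s) + g) / 2) /
        Real.sin (α * (x (chain p hn t) - x (chain p hn s)) / 2) =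
        hsin α (x (chain p hn s) - x (chain p hn t) - g) /
          hsin α (x (chain p hn s) - x (chain p hn t)) := by
      rw [← neg_div_neg_eq, ← Real.sin_neg, ← Real.sin_neg]
      unfold hsin
      congr 2 <;> ring
    rw [e2]
    simp only [e1]
    unfold pairFactor
    generalize ν (chain p hn s) - ν (chain p hn t) = δ
    rcases eq_or_ne δ 1 with rfl | hd
    · norm_num [hsin]
    · simp [hd]
  · rw [if_neg hst, if_neg hst]

lemma Delta_eq_prod_rootWeight {ω : ℕ → Fin n → ℝ} {α g : ℝ} (hp : 1 ≤ p) (hpn : p ≤ n - 1)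
    (hcop : Nat.Coprime p n)
    (hωδ : ∀ j : ℕ, 1 ≤ j → j ≤ n - 1 → ∀ k : ℕ, 1 ≤ k → k ≤ n - 1 →
      inn (aa n p j) (ω k) = if j = k then (1 : ℝ) else 0)
    (hM : 2 * π * p / α - n * g ≠ 0) {μ : Fin n → ℝ} {w : ℕ → ℕ}
    (hw : ∀ s t : ℕ, s < t → t < n →
      μ (chain p hn s) - μ (chain p hn t) = ((∑ i ∈ Finset.Ico s t, w i : ℕ) : ℝ)) :
    Delta n p α g ω μ = ∏ s ∈ Finset.range n, ∏ t ∈ Finset.range n, if s < t then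
      rootWeight α g (Real.sign (2 * π * p / α - n * g))
        (((t - s : ℕ) : ℝ) * g - (winding n p t - winding n p s : ℤ) * (2 * π / α))
        (∑ i ∈ Finset.Ico s t, w i)
      else 1 := by
  unfold Delta
  simp_rw [prod_Icc_eq_prod_chain hn hp hcop, inn_add_right, inn_smul_right, inn_ee_sub_ee]
  refine Finset.prod_congr rfl fun s hs => Finset.prod_congr rfl fun t ht => ?_
  rw [Finset.mem_range] at hs ht
  simp only [inPosRoots_chain_iff hn hp hcop hωδ hs ht]
  split_ifs with hst
  · rw [rhoP_chain_sub hn hp hpn hcop hωδ hst.le ht]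
    exact rootWeight_eq_poch _ _ _ _ _ _ (Real.sign_apply_eq_of_ne_zero _ hM) (hw s t hst ht)
  · rfl

lemma prod_lt_mul (N : ℕ) (f f' : ℕ → ℕ → ℝ) :
    (∏ s ∈ Finset.range N, ∏ t ∈ Finset.range N, if s < t then f s t else 1) *
      (∏ s ∈ Finset.range N, ∏ t ∈ Finset.range N, if s < t then f' s t else 1) =
    ∏ s ∈ Finset.range N, ∏ t ∈ Finset.range N, if s < t then f s t * f' s t else 1 := by
  simp_rw [← Finset.prod_mul_distrib]
  refine Finset.prod_congr rfl fun s _ => Finset.prod_congr rfl fun t _ => ?_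
  split_ifs <;> simp

lemma prod_lt_congr {N : ℕ} {f f' : ℕ → ℕ → ℝ} (h : ∀ s t, s < t → t < N → f s t = f' s t) :
    (∏ s ∈ Finset.range N, ∏ t ∈ Finset.range N, if s < t then f s t else 1) =
    ∏ s ∈ Finset.range N, ∏ t ∈ Finset.range N, if s < t then f' s t else 1 := by
  refine Finset.prod_congr rfl fun s _ => Finset.prod_congr rfl fun t ht => ?_
  split_ifs with hst
  · exact h s t hst (Finset.mem_range.1 ht)
  · rfl

lemma prod_lt_pos {N : ℕ} {f : ℕ → ℕ → ℝ} (h : ∀ s t, s < t → t < N → 0 < f s t) :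
    0 < ∏ s ∈ Finset.range N, ∏ t ∈ Finset.range N, if s < t then f s t else 1 := by
  refine Finset.prod_pos fun s _ => Finset.prod_pos fun t ht => ?_
  split_ifs with hst
  · exact h s t hst (Finset.mem_range.1 ht)
  · exact one_pos

lemma prod_lt_nonneg {N : ℕ} {f : ℕ → ℕ → ℝ} (h : ∀ s t, s < t → t < N → 0 ≤ f s t) :
    0 ≤ ∏ s ∈ Finset.range N, ∏ t ∈ Finset.range N, if s < t then f s t else 1 := by
  refine Finset.prod_nonneg fun s _ => Finset.prod_nonneg fun t ht => ?_
  split_ifs with hst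
  · exact h s t hst (Finset.mem_range.1 ht)
  · exact zero_le_one

variable {ω : ℕ → Fin n → ℝ} {α g : ℝ} {σ : ℕ → ℝ}

lemma Delta_pos (hα : 0 < α) (hp : 1 ≤ p) (hpn : p ≤ n - 1) (hcop : Nat.Coprime p n)
    (hωδ : ∀ j : ℕ, 1 ≤ j → j ≤ n - 1 → ∀ k : ℕ, 1 ≤ k → k ≤ n - 1 →
      inn (aa n p j) (ω k) = if j = k then (1 : ℝ) else 0)
    (hM : 2 * π * p / α - n * g ≠ 0)
    (hσ : SignPattern n p α g (Real.sign (2 * π * p / α - n * g)) |2 * π * p / α - n * g| σ)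
    {μ : Fin n → ℝ} (hμ : μ ∈ Lam n |2 * π * p / α - n * g| ω) : 0 < Delta n p α g ω μ := by
  have hn : 0 < n := by omega
  obtain ⟨w, hw⟩ := exists_chain_weights hn hp hcop hωδ hμ
  rw [Delta_eq_prod_rootWeight hn hp hpn hcop hωδ hM fun s t h1 h2 => (hw s t h1 h2).1]
  have hmul := prod_lt_mul n
    (fun s t => (σ (t - s + 1) * σ (t - s - 1)) ^ ∑ i ∈ Finset.Ico s t, w i)
    (fun s t => rootWeight α g (Real.sign (2 * π * p / α - n * g))
      (((t - s : ℕ) : ℝ) * g - (winding n p t - winding n p s : ℤ) * (2 * π / α))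
      (∑ i ∈ Finset.Ico s t, w i))
  rw [hσ.prod_pairs hcop w, one_mul] at hmul
  rw [hmul]
  exact prod_lt_pos fun s t hst ht =>
    hσ.rootWeight_pos hα (by omega) (by omega) _ (hw s t hst ht).2

lemma Delta_mul_Vnu (hα : 0 < α) (hp : 1 ≤ p) (hpn : p ≤ n - 1) (hcop : Nat.Coprime p n)
    (hωδ : ∀ j : ℕ, 1 ≤ j → j ≤ n - 1 → ∀ k : ℕ, 1 ≤ k → k ≤ n - 1 →
      inn (aa n p j) (ω k) = if j = k then (1 : ℝ) else 0)
    (hM : 2 * π * p / α - n * g ≠ 0)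
    (hσ : SignPattern n p α g (Real.sign (2 * π * p / α - n * g)) |2 * π * p / α - n * g| σ)
    {μ ν : Fin n → ℝ} (hμ : μ ∈ Lam n |2 * π * p / α - n * g| ω)
    (hμν : μ + ν ∈ Lam n |2 * π * p / α - n * g| ω)
    (hν : ∀ i j, ν i - ν j = 1 ∨ ν i - ν j = -1 ∨ ν i - ν j = 0) :
    Delta n p α g ω (μ + ν) * Vnu n α g ν
        (-(rhoP n p α g ω) - Real.sign (2 * π * p / α - n * g) • (μ + ν)) =
      Delta n p α g ω μ *
        Vnu n α g ν (rhoP n p α g ω + Real.sign (2 * π * p / α - n * g) • μ) := by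
  have hn : 0 < n := by omega
  obtain ⟨w, hw⟩ := exists_chain_weights hn hp hcop hωδ hμ
  obtain ⟨w', hw'⟩ := exists_chain_weights hn hp hcop hωδ hμν
  rw [Delta_eq_prod_rootWeight hn hp hpn hcop hωδ hM fun s t h1 h2 => (hw s t h1 h2).1,
    Delta_eq_prod_rootWeight hn hp hpn hcop hωδ hM fun s t h1 h2 => (hw' s t h1 h2).1,
    Vnu_eq_prod_pairFactor hn hp hcop, Vnu_eq_prod_pairFactor hn hp hcop, prod_lt_mul,
    prod_lt_mul]
  refine prod_lt_congr fun s t hst ht => ?_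
  have hr := rhoP_chain_sub (α := α) (g := g) hn hp hpn hcop hωδ hst.le ht
  obtain ⟨h1, h2⟩ := hw s t hst ht
  obtain ⟨h1', h2'⟩ := hw' s t hst ht
  have b := hσ.rootWeight_balance hα (k := t - s) (by omega) (by omega)
    (winding n p t - winding n p s) (hν (chain p hn s) (chain p hn t)) h2 h2'
    (by rw [← h1, ← h1', Pi.add_apply, Pi.add_apply]; ring)
  rw [← pairFactor_neg] at b
  convert b using 3
  · rw [← hr, ← h1']
    simp only [Pi.sub_apply, Pi.neg_apply, Pi.smul_apply, smul_eq_mul]; ring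
  · rw [← hr, ← h1]
    simp only [Pi.add_apply, Pi.smul_apply, smul_eq_mul]; ring

/-- `V_ν` does not change sign on the closed simplex. -/
lemma sign_Vnu_center_mul (hα : 0 < α) (hp : 1 ≤ p) (hpn : p ≤ n - 1) (hcop : Nat.Coprime p n)
    (hωδ : ∀ j : ℕ, 1 ≤ j → j ≤ n - 1 → ∀ k : ℕ, 1 ≤ k → k ≤ n - 1 →
      inn (aa n p j) (ω k) = if j = k then (1 : ℝ) else 0)
    (hM : 2 * π * p / α - n * g ≠ 0)
    (hσ : SignPattern n p α g (Real.sign (2 * π * p / α - n * g)) |2 * π * p / α - n * g| σ)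
    {μ : Fin n → ℝ} (ν : Fin n → ℝ) (hμ : μ ∈ Lam n |2 * π * p / α - n * g| ω) :
    Real.sign (Vnu n α g ν (simplexCenter n α)) *
        |Vnu n α g ν (rhoP n p α g ω + Real.sign (2 * π * p / α - n * g) • μ)| =
      Vnu n α g ν (rhoP n p α g ω + Real.sign (2 * π * p / α - n * g) • μ) := by
  have hn : 0 < n := by omega
  obtain ⟨w, hw⟩ := exists_chain_weights hn hp hcop hωδ hμ
  have hB := abs_pos.2 hM
  have hn0 : (0 : ℝ) < n := by exact_mod_cast hn
  obtain ⟨a, ha⟩ : ∃ a, a = ∏ s ∈ Finset.range n, ∏ t ∈ Finset.range n, if s < t then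
    pairSign σ (ν (chain p hn s) - ν (chain p hn t)) (t - s) else 1 := ⟨_, rfl⟩
  have hx : 0 ≤ a *
      Vnu n α g ν (rhoP n p α g ω + Real.sign (2 * π * p / α - n * g) • μ) := by
    rw [Vnu_eq_prod_pairFactor hn hp hcop, ha, prod_lt_mul]
    refine prod_lt_nonneg fun s t hst ht => ?_
    have hr := rhoP_chain_sub (α := α) (g := g) hn hp hpn hcop hωδ hst.le ht
    obtain ⟨h1, h2⟩ := hw s t hst ht
    have := (hσ.pairSign_mul hα (k := t - s) (by omega) (by omega)
      (winding n p t - winding n p s) (ν (chain p hn s) - ν (chain p hn t))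
      (Nat.cast_nonneg _) h2).1
    convert this using 3
    rw [← hr, ← h1]
    simp only [Pi.add_apply, Pi.smul_apply, smul_eq_mul]; ring
  have hc : 0 < a * Vnu n α g ν (simplexCenter n α) := by
    rw [Vnu_eq_prod_pairFactor hn hp hcop, ha, prod_lt_mul]
    refine prod_lt_pos fun s t hst ht => ?_
    rw [simplexCenter_chain_sub (g := g) hn hp hst.le]
    have k0 : (0 : ℝ) < (t - s : ℕ) := by
      have : 0 < t - s := by omega
      exact_mod_cast this
    have k1 : ((t - s : ℕ) : ℝ) / n < 1 := by
      rw [div_lt_one hn0]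
      have : t - s < n := by omega
      exact_mod_cast this
    have hpos : 0 < |2 * π * p / α - n * g| * ((t - s : ℕ) / n) := by positivity
    have hlt : |2 * π * p / α - n * g| * ((t - s : ℕ) / n) < |2 * π * p / α - n * g| := by
      nlinarith
    exact (hσ.pairSign_mul hα (k := t - s) (by omega) (by omega)
      (winding n p t - winding n p s) (ν (chain p hn s) - ν (chain p hn t))
      hpos.le hlt.le).2 hpos hlt
  rcases lt_trichotomy a 0 with h0 | h0 | h0
  · rw [Real.sign_of_neg (by nlinarith), abs_of_nonpos (by nlinarith)]; ring
  · rw [h0, zero_mul] at hc; exact absurd hc (lt_irrefl _)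
  · rw [Real.sign_of_pos (by nlinarith), abs_of_nonneg (by nlinarith)]; ring

end

lemma omegaStd_perm_sub {n : ℕ} (r : ℕ) (τ : Equiv.Perm (Fin n)) (i j : Fin n) :
    omegaStd n r (τ i) - omegaStd n r (τ j) = 1 ∨ omegaStd n r (τ i) - omegaStd n r (τ j) = -1 ∨
      omegaStd n r (τ i) - omegaStd n r (τ j) = 0 := by
  unfold omegaStd
  split_ifs
  · right; right; ring
  · left; ring
  · right; left; ring
  · right; right; ring

lemma mul_sqrt_mul_sqrt_of_balance {c V V' D D' : ℝ} (hD : 0 < D) (hD' : 0 < D')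
    (hbal : D' * V' = D * V) (hV : c * |V| = V) : c * √(V * V') * √D' = √D * V := by
  rw [mul_assoc, ← Real.sqrt_mul' _ hD'.le,
    show V * V' * D' = D * V ^ 2 by linear_combination V * hbal, Real.sqrt_mul hD.le,
    Real.sqrt_sq_eq_abs]
  linear_combination √D * hV

/-- Corollary 3.3, intertwining relation:
`Σ_ν W_ν(ρ_p+sgn(M)μ)·√Δ_p(μ+ν)·φ(ρ_p+sgn(M)(μ+ν))
  = √Δ_p(μ)·Σ_ν V_ν(g;ρ_p+sgn(M)μ)·φ(ρ_p+sgn(M)(μ+ν))`,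
sums over `ν ∈ S_n(ω_r)` with `μ+ν ∈ Λ⁺_{p,|M|}`. -/
theorem statement16 (n p q : ℕ) (α g : ℝ)
    (hn : 2 ≤ n) (hα : 0 < α) (hp1 : 1 ≤ p) (hpn : p ≤ n - 1) (hcop : Nat.Coprime p n)
    (htype : TypeI n p q α g)
    (Mz : ℤ) (hMz : 2 * π * p / α - n * g = (Mz : ℝ)) (hMz0 : Mz ≠ 0)
    (ω : ℕ → Fin n → ℝ)
    (hωE : ∀ k : ℕ, 1 ≤ k → k ≤ n - 1 → ∑ i, ω k i = 0)
    (hωδ : ∀ j : ℕ, 1 ≤ j → j ≤ n - 1 → ∀ k : ℕ, 1 ≤ k → k ≤ n - 1 →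
      inn (aa n p j) (ω k) = if j = k then (1 : ℝ) else 0)
    (s : (Fin n → ℝ) → ℝ)
    (hs : ∀ r : ℕ, 1 ≤ r → r ≤ n - 1 → ∀ ν : Fin n → ℝ, inOrbit n r ν →
      ∀ x ∈ SigmaInt n p α g, s ν = Real.sign (Vnu n α g ν x))
    (r : ℕ) (hr1 : 1 ≤ r) (hrn : r ≤ n - 1)
    (φ : (Fin n → ℝ) → ℂ)
    (μ : Fin n → ℝ) (hμ : μ ∈ Lam n |2 * π * p / α - n * g| ω) :
    (∑ ν ∈ orbitF n r,
        if μ + ν ∈ Lam n |2 * π * p / α - n * g| ω then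
          ((Wmu n p α g ω s μ ν * Real.sqrt (Delta n p α g ω (μ + ν)) : ℝ) : ℂ) *
            φ (rhoP n p α g ω + Real.sign (2 * π * p / α - n * g) • (μ + ν))
        else 0) =
      ((Real.sqrt (Delta n p α g ω μ) : ℝ) : ℂ) *
        ∑ ν ∈ orbitF n r,
          if μ + ν ∈ Lam n |2 * π * p / α - n * g| ω then
            ((Vnu n α g ν
                (rhoP n p α g ω + Real.sign (2 * π * p / α - n * g) • μ) : ℝ) : ℂ) *
              φ (rhoP n p α g ω + Real.sign (2 * π * p / α - n * g) • (μ + ν))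
          else 0 := by
  have hM : 2 * π * p / α - n * g ≠ 0 := by rw [hMz]; exact_mod_cast hMz0
  obtain ⟨σ, hσ⟩ := exists_signPattern hn hα hp1 hcop htype hM
  have hcenter := simplexCenter_mem (p := p) (α := α) (g := g) (by omega) hM
  rw [Finset.mul_sum]
  refine Finset.sum_congr rfl fun ν hν => ?_
  split_ifs with hμν
  · obtain ⟨τ, -, hτ⟩ := Finset.mem_image.1 hν
    have hdiff : ∀ i j, ν i - ν j = 1 ∨ ν i - ν j = -1 ∨ ν i - ν j = 0 := by
      intro i j; rw [← hτ]; exact omegaStd_perm_sub r τ i j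
    have hsign := hs r hr1 hrn ν ⟨τ, hτ.symm⟩ _ hcenter
    have hV := sign_Vnu_center_mul hα hp1 hpn hcop hωδ hM hσ ν hμ
    have hbal := Delta_mul_Vnu hα hp1 hpn hcop hωδ hM hσ hμ hμν hdiff
    have hΔ := Delta_pos hα hp1 hpn hcop hωδ hM hσ hμ
    have hΔ' := Delta_pos hα hp1 hpn hcop hωδ hM hσ hμν
    have key : Wmu n p α g ω s μ ν * Real.sqrt (Delta n p α g ω (μ + ν)) =
        Real.sqrt (Delta n p α g ω μ) *
          Vnu n α g ν (rhoP n p α g ω + Real.sign (2 * π * p / α - n * g) • μ) := by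
      rw [Wmu, if_pos hμν, hsign]
      exact mul_sqrt_mul_sqrt_of_balance hΔ hΔ' hbal hV
    rw [key]
    push_cast
    ring
  · simp
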